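/- Let N ≥ 4 be an integer, let p ≠ q be partitions of [k], let α, β ∈ ℂ both be nonzero, and suppose ξ = α ξ_p + β ξ_q is nonzero. Then ⟨NC, ξ⟩ = P or ⟨NC, ξ⟩ = NC (equality of families meaning equality of each subspace C(k',ℓ')). -/

import Mathlib

open scoped Classical

/-- The block relation of a finite partition of `Fin n` (partition of `[n]`):
`x ∼_p y` iff `x` and `y` lie in the same block of `p`. -/
def PartRel {n : ℕ} (p : Finpartition (Finset.univ : Finset (Fin n))) (x y : Fin n) : Prop :=
  ∃ B ∈ p.parts, x ∈ B ∧ y ∈ B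

/-- `κ` is a crossing of the relation `r`: `κ = {a,b,c,d}` with `a < b < c < d`,
`r a c`, `r b d`, and `¬ r a b`. -/
def IsCross {n : ℕ} (r : Fin n → Fin n → Prop) (κ : Finset (Fin n)) : Prop :=
  ∃ a b c d : Fin n, a < b ∧ b < c ∧ c < d ∧ κ = {a, b, c, d} ∧ r a c ∧ r b d ∧ ¬ r a b

/-- `cr p`: the set of crossings of the partition `p`. -/
def cr {n : ℕ} (p : Finpartition (Finset.univ : Finset (Fin n))) : Set (Finset (Fin n)) :=
  {κ | IsCross (PartRel p) κ}


/-- `crossers p` (`χ(p)`): the union of all crossings of `p`. -/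
def crossers {n : ℕ} (p : Finpartition (Finset.univ : Finset (Fin n))) : Set (Fin n) :=
  {x | ∃ κ ∈ cr p, x ∈ κ}

/-- The vector `ξ_p ∈ (ℂ^N)^{⊗k}`, identified with `(Fin k → Fin N) → ℂ`:
its coordinate at `i` is `1` if `i` is constant on every block of `p`, else `0`. -/
noncomputable def xi (N : ℕ) {k : ℕ} (p : Finpartition (Finset.univ : Finset (Fin k))) :
    (Fin k → Fin N) → ℂ :=
  fun i => if ∀ x y, PartRel p x y → i x = i y then 1 else 0

/-- The span of the noncrossing-partition vectors `ξ_p`, `p ∈ NC(k)`. -/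
noncomputable def ncSpan (N k : ℕ) : Submodule ℂ ((Fin k → Fin N) → ℂ) :=
  Submodule.span ℂ
    {v | ∃ p : Finpartition (Finset.univ : Finset (Fin k)), cr p = ∅ ∧ v = xi N p}

/-- The span of the crossing-partition vectors `ξ_p`, `p ∈ CR(k)`. -/
noncomputable def crSpan (N k : ℕ) : Submodule ℂ ((Fin k → Fin N) → ℂ) :=
  Submodule.span ℂ
    {v | ∃ p : Finpartition (Finset.univ : Finset (Fin k)), (cr p).Nonempty ∧ v = xi N p}

/-- The span of all partition vectors `ξ_p`, `p ∈ P(k)`. -/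
noncomputable def allSpan (N k : ℕ) : Submodule ℂ ((Fin k → Fin N) → ℂ) :=
  Submodule.span ℂ
    {v | ∃ p : Finpartition (Finset.univ : Finset (Fin k)), v = xi N p}

/-- Linear maps `(ℂ^N)^{⊗k} → (ℂ^N)^{⊗ℓ}`, as matrices with rows indexed by
lower index tuples and columns by upper index tuples. -/
abbrev Mat (N k ℓ : ℕ) := Matrix (Fin ℓ → Fin N) (Fin k → Fin N) ℂ

/-- The tensor product of two such linear maps. -/
def tensorMat {N k ℓ k' ℓ' : ℕ} (S : Mat N k ℓ) (T : Mat N k' ℓ') :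
    Mat N (k + k') (ℓ + ℓ') :=
  fun i j =>
    S (fun a => i (Fin.castAdd ℓ' a)) (fun b => j (Fin.castAdd k' b)) *
      T (fun a => i (Fin.natAdd ℓ a)) (fun b => j (Fin.natAdd k b))

/-- The cup: the map `(ℂ^N)^{⊗2} → ℂ` sending `e_i ⊗ e_j` to `δ_{ij}`. -/
def cupMat (N : ℕ) : Mat N 2 0 := fun _ j => if j 0 = j 1 then 1 else 0

/-- A Tannaka–Krein dual at parameter `N`: a family of subspaces
`C k ℓ ⊆ Hom((ℂ^N)^{⊗k}, (ℂ^N)^{⊗ℓ})` closed under tensor products, composition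
and adjoints, containing the identity of `ℂ^N` and the cup. -/
structure TKDual (N : ℕ) where
  C : ∀ k ℓ : ℕ, Submodule ℂ (Mat N k ℓ)
  tensor_mem : ∀ {k ℓ k' ℓ' : ℕ} {S : Mat N k ℓ} {T : Mat N k' ℓ'},
    S ∈ C k ℓ → T ∈ C k' ℓ' → tensorMat S T ∈ C (k + k') (ℓ + ℓ')
  comp_mem : ∀ {k ℓ r : ℕ} {S : Mat N ℓ r} {T : Mat N k ℓ},
    S ∈ C ℓ r → T ∈ C k ℓ → S * T ∈ C k r
  adj_mem : ∀ {k ℓ : ℕ} {T : Mat N k ℓ}, T ∈ C k ℓ → T.conjTranspose ∈ C ℓ k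
  id_mem : (1 : Matrix (Fin 1 → Fin N) (Fin 1 → Fin N) ℂ) ∈ C 1 1
  cup_mem : cupMat N ∈ C 2 0

/-- The involution of `Fin (k + ℓ)` fixing the first `k` (upper) points and
reversing the order of the last `ℓ` (lower) points. -/
def lowerRev (k ℓ : ℕ) : Fin (k + ℓ) → Fin (k + ℓ) :=
  Fin.append (fun a : Fin k => Fin.castAdd ℓ a) (fun a : Fin ℓ => Fin.natAdd k a.rev)

/-- A partition of `[k + ℓ]` (first `k` points upper, last `ℓ` points lower) is
noncrossing when the partition obtained by reversing the order of the lower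
points has no crossing. -/
def IsNCPart {k ℓ : ℕ} (p : Finpartition (Finset.univ : Finset (Fin (k + ℓ)))) : Prop :=
  ∀ κ, ¬ IsCross (fun x y => PartRel p (lowerRev k ℓ x) (lowerRev k ℓ y)) κ

/-- The linear map `T_p : (ℂ^N)^{⊗k} → (ℂ^N)^{⊗ℓ}` of a partition `p` of `[k + ℓ]`:
its entry at (lower tuple `i`, upper tuple `j`) is `1` if the labelling of the points
of `p` by `j` on the upper points and `i` on the lower points is constant on each
block of `p`, and `0` otherwise. -/
noncomputable def Tmat (N : ℕ) (k ℓ : ℕ)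
    (p : Finpartition (Finset.univ : Finset (Fin (k + ℓ)))) : Mat N k ℓ :=
  fun i j => if ∀ x y, PartRel p x y → Fin.append j i x = Fin.append j i y then 1 else 0

/-- The family `P(k,ℓ) = span{T_p : p a partition of [k+ℓ]}`. -/
noncomputable def Pfam (N k ℓ : ℕ) : Submodule ℂ (Mat N k ℓ) :=
  Submodule.span ℂ (Set.range (Tmat N k ℓ))

/-- The family `NC(k,ℓ) = span{T_p : p a noncrossing partition of [k+ℓ]}`. -/
noncomputable def NCfam (N k ℓ : ℕ) : Submodule ℂ (Mat N k ℓ) :=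
  Submodule.span ℂ {T | ∃ p, IsNCPart p ∧ T = Tmat N k ℓ p}

/-- A vector in `(ℂ^N)^{⊗k}` viewed as a linear map `(ℂ^N)^{⊗0} → (ℂ^N)^{⊗k}`. -/
def vecMat {N k : ℕ} (v : (Fin k → Fin N) → ℂ) : Mat N 0 k := fun i _ => v i

/-- `⟨NC, ξ⟩`: the smallest Tannaka–Krein dual containing all of `NC` together with
the vector `ξ ∈ (ℂ^N)^{⊗k}` (in degree `(0,k)`), i.e. the intersection of all such. -/
noncomputable def genNCxi (N : ℕ) {k : ℕ} (ξ : (Fin k → Fin N) → ℂ) (k' ℓ' : ℕ) :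
    Submodule ℂ (Mat N k' ℓ') :=
  ⨅ (C : TKDual N) (_ : ∀ a b, NCfam N a b ≤ C.C a b) (_ : vecMat ξ ∈ C.C 0 k),
    C.C k' ℓ'

/-! ### Setoids and noncrossing relations -/

/-- The setoid obtained from `r` by merging the classes of `a` and `b`. -/
def mergeSetoid {X : Type*} (r : Setoid X) (a b : X) : Setoid X where
  r x y := r x y ∨ (r x a ∧ r b y) ∨ (r x b ∧ r a y)
  iseqv := by
    have hs := @Setoid.symm' X r
    have ht := @Setoid.trans' X r
    refine ⟨fun x => Or.inl (r.refl' x), ?_, ?_⟩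
    · rintro x y (h | ⟨h, h'⟩ | ⟨h, h'⟩)
      · exact Or.inl (hs h)
      · exact Or.inr (Or.inr ⟨hs h', hs h⟩)
      · exact Or.inr (Or.inl ⟨hs h', hs h⟩)
    · rintro x y z (h | ⟨h, h'⟩ | ⟨h, h'⟩) (g | ⟨g, g'⟩ | ⟨g, g'⟩)
      · exact Or.inl (ht h g)
      · exact Or.inr (Or.inl ⟨ht h g, g'⟩)
      · exact Or.inr (Or.inr ⟨ht h g, g'⟩)
      · exact Or.inr (Or.inl ⟨h, ht h' g⟩)
      · exact Or.inr (Or.inl ⟨h, g'⟩)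
      · exact Or.inl (ht h g')
      · exact Or.inr (Or.inr ⟨h, ht h' g⟩)
      · exact Or.inl (ht h g')
      · exact Or.inr (Or.inr ⟨h, g'⟩)

theorem mergeSetoid_apply {X : Type*} (r : Setoid X) (a b x y : X) :
    mergeSetoid r a b x y ↔ r x y ∨ (r x a ∧ r b y) ∨ (r x b ∧ r a y) := Iff.rfl

theorem mergeSetoid_eq_self {X : Type*} {r : Setoid X} {a b : X} (h : r a b) :
    mergeSetoid r a b = r := by
  ext x y
  rw [mergeSetoid_apply]
  have ht := @Setoid.trans' X r
  have hs := @Setoid.symm' X r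
  constructor
  · rintro (h' | ⟨h1, h2⟩ | ⟨h1, h2⟩)
    · exact h'
    · exact ht h1 (ht h h2)
    · exact ht h1 (ht (hs h) h2)
  · exact Or.inl

/-- `f` is constant on the classes of `r`. -/
def ConstOn {X Y : Type*} (r : Setoid X) (f : X → Y) : Prop := ∀ x y, r x y → f x = f y

theorem constOn_mergeSetoid {X Y : Type*} (r : Setoid X) (a b : X) (f : X → Y) :
    ConstOn (mergeSetoid r a b) f ↔ ConstOn r f ∧ f a = f b := by
  constructor
  · intro h
    exact ⟨fun x y hxy => h x y (Or.inl hxy), h a b (Or.inr (Or.inl ⟨r.refl' a, r.refl' b⟩))⟩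
  · rintro ⟨h, hab⟩ x y (h' | ⟨h1, h2⟩ | ⟨h1, h2⟩)
    · exact h x y h'
    · rw [h x a h1, hab, h b y h2]
    · rw [h x b h1, ← hab, h a y h2]

/-- The disjoint union of two setoids. -/
def sumSetoid {X Y : Type*} (r : Setoid X) (s : Setoid Y) : Setoid (X ⊕ Y) where
  r := Sum.LiftRel r s
  iseqv := by
    refine ⟨?_, ?_, ?_⟩
    · rintro (x | x)
      · exact .inl (r.refl' x)
      · exact .inr (s.refl' x)
    · rintro _ _ (⟨h⟩ | ⟨h⟩)
      · exact .inl (r.symm' h)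
      · exact .inr (s.symm' h)
    · rintro _ _ _ (⟨h⟩ | ⟨h⟩) (⟨g⟩ | ⟨g⟩)
      · exact .inl (r.trans' h g)
      · exact .inr (s.trans' h g)

theorem sumSetoid_apply {X Y : Type*} (r : Setoid X) (s : Setoid Y) (x y : X ⊕ Y) :
    sumSetoid r s x y ↔ Sum.LiftRel r s x y := Iff.rfl

theorem constOn_sumSetoid {X Y Z : Type*} (r : Setoid X) (s : Setoid Y) (f : X ⊕ Y → Z) :
    ConstOn (sumSetoid r s) f ↔ ConstOn r (f ∘ Sum.inl) ∧ ConstOn s (f ∘ Sum.inr) := by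
  constructor
  · intro h
    exact ⟨fun x y hxy => h _ _ (.inl hxy), fun x y hxy => h _ _ (.inr hxy)⟩
  · rintro ⟨h1, h2⟩ _ _ (⟨h⟩ | ⟨h⟩)
    · exact h1 _ _ h
    · exact h2 _ _ h

/-- The setoid `r` has no crossing among the points of `A`, ordered by `pos`. -/
def NoncrossingOn {X : Type*} (pos : X → ℤ) (r : Setoid X) (A : Set X) : Prop :=
  ∀ ⦃a b c d⦄, a ∈ A → b ∈ A → c ∈ A → d ∈ A → pos a < pos b → pos b < pos c →
    pos c < pos d → r a c → r b d → r a b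

theorem NoncrossingOn.mono {X : Type*} {pos : X → ℤ} {r : Setoid X} {A B : Set X}
    (h : NoncrossingOn pos r A) (hB : B ⊆ A) : NoncrossingOn pos r B :=
  fun _ _ _ _ ha hb hc hd => h (hB ha) (hB hb) (hB hc) (hB hd)

theorem NoncrossingOn.comap {X Y : Type*} {pos : X → ℤ} {r : Setoid X} {A : Set X}
    (h : NoncrossingOn pos r A) {e : Y → X} {pos' : Y → ℤ}
    (he : ∀ y, e y ∈ A) (hpos : ∀ y z, pos' y < pos' z → pos (e y) < pos (e z)) :
    NoncrossingOn pos' (Setoid.comap e r) Set.univ :=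
  fun a b c d _ _ _ _ hab hbc hcd h1 h2 => h (he a) (he b) (he c) (he d)
    (hpos _ _ hab) (hpos _ _ hbc) (hpos _ _ hcd) h1 h2

/-- A union of two noncrossing setoids, the second of which is inserted at one place of the
first, is noncrossing. -/
theorem NoncrossingOn.sumSetoid {X Y : Type*} {pos : X ⊕ Y → ℤ} {r : Setoid X} {s : Setoid Y}
    (hr : NoncrossingOn (pos ∘ Sum.inl) r Set.univ)
    (hs : NoncrossingOn (pos ∘ Sum.inr) s Set.univ)
    (hpos : ∀ x y y', pos (.inr y) < pos (.inl x) → ¬ pos (.inl x) < pos (.inr y')) :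
    NoncrossingOn pos (sumSetoid r s) Set.univ := by
  intro a b c d _ _ _ _ hab hbc hcd hac hbd
  rw [sumSetoid_apply] at *
  rcases hac with ⟨hac⟩ | ⟨hac⟩ <;> rcases hbd with ⟨hbd⟩ | ⟨hbd⟩
  · exact .inl (hr trivial trivial trivial trivial hab hbc hcd hac hbd)
  · exact absurd hcd (hpos _ _ _ hbc)
  · exact absurd hbc (hpos _ _ _ hab)
  · exact .inr (hs trivial trivial trivial trivial hab hbc hcd hac hbd)

/-- Merging the classes of two neighbours creates no crossing. -/
theorem NoncrossingOn.mergeSetoid {X : Type*} {pos : X → ℤ} {r : Setoid X} {A : Set X}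
    (h : NoncrossingOn pos r A) {x y : X} (hx : x ∈ A) (hy : y ∈ A) (hxy : pos x < pos y)
    (hadj : ∀ z ∈ A, pos z < pos x ∨ z = x ∨ z = y ∨ pos y < pos z) :
    NoncrossingOn pos (mergeSetoid r x y) A := by
  have hs : ∀ {x y}, r x y → r y x := r.symm'
  have ht : ∀ {x y z}, r x y → r y z → r x z := r.trans'
  intro a b c d ha hb hc hd hab hbc hcd hac hbd
  rw [mergeSetoid_apply] at *
  have H : ∀ ⦃u v s t⦄, u ∈ A → v ∈ A → s ∈ A → t ∈ A → pos u < pos s → pos s < pos v →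
      (pos t < pos u ∨ pos v < pos t) → r u v → r s t → r u s := by
    rintro u v s t hu hv hs' ht' h1 h2 (h3 | h3) huv hst
    · exact ht (hs (h ht' hu hs' hv h3 h1 h2 (hs hst) huv)) (hs hst)
    · exact h hu hs' hv ht' h1 h2 h3 huv hst
  rcases hac with hac | ⟨h1, h2⟩ | ⟨h1, h2⟩ <;> rcases hbd with hbd | ⟨h3, h4⟩ | ⟨h3, h4⟩
  · exact Or.inl (h ha hb hc hd hab hbc hcd hac hbd)
  · by_cases hxo : pos x < pos a ∨ pos c < pos x
    · exact Or.inl (H ha hc hb hx hab hbc hxo hac h3)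
    · have := H ha hc hy hd
      have := hadj a ha
      have := hadj c hc
      clear H h hadj
      grind
  · by_cases hxo : pos y < pos a ∨ pos c < pos y
    · exact Or.inl (H ha hc hb hy hab hbc hxo hac h3)
    · have := H ha hc hx hd
      have := hadj a ha
      have := hadj c hc
      clear H h hadj
      grind
  · by_cases hxo : pos y < pos b ∨ pos d < pos y
    · have := H hb hd hc hy hbc hcd hxo hbd (hs h2)
      exact Or.inr (Or.inl ⟨h1, hs (ht this (hs h2))⟩)
    · have := H hb hd hx ha
      have := hadj b hb
      have := hadj d hd
      clear H h hadj
      grind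
  · exact Or.inl (ht h1 (hs h3))
  · exact Or.inr (Or.inl ⟨h1, hs h3⟩)
  · by_cases hxo : pos x < pos b ∨ pos d < pos x
    · have := H hb hd hc hx hbc hcd hxo hbd (hs h2)
      exact Or.inr (Or.inr ⟨h1, hs (ht this (hs h2))⟩)
    · have := H hb hd hy ha
      have := hadj b hb
      have := hadj d hd
      clear H h hadj
      grind
  · exact Or.inr (Or.inr ⟨h1, hs h3⟩)
  · exact Or.inl (ht h1 (hs h3))

/-- A labelling of a word whose restriction to any three letters has no strict minimum in the
middle has a noncrossing kernel. -/
theorem noncrossingOn_ker_of_unimodal {X : Type*} {pos : X → ℤ} {lab : X → ℕ}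
    (h : ∀ a b c, pos a < pos b → pos b < pos c → lab a ≤ lab b ∨ lab c ≤ lab b) :
    NoncrossingOn pos (Setoid.ker lab) Set.univ := by
  intro a b c d _ _ _ _ hab hbc hcd hac hbd
  rw [Setoid.ker_def] at *
  have := h a b c hab hbc
  have := h b c d hbc hcd
  omega

/-! ### Counting functions that are constant on classes -/

/-- The number of classes of `J` that do not meet the range of `e`. -/
noncomputable def freeClasses {A X : Type*} (e : A → X) (J : Setoid X) : ℕ :=
  Nat.card {B : Quotient J // ∀ a, (Quotient.mk J (e a)) ≠ B}

theorem card_constOn {A X : Type*} [Fintype X] {N : ℕ} (e : A → X) (J : Setoid X)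
    (g : A → Fin N) :
    (Finset.univ.filter fun f : X → Fin N => f ∘ e = g ∧ ConstOn J f).card =
      if ConstOn (Setoid.comap e J) g then N ^ freeClasses e J else 0 := by
  split_ifs with hg
  · have E : {f : X → Fin N // f ∘ e = g ∧ ConstOn J f} ≃
        ({B : Quotient J // ∀ a, (Quotient.mk J (e a)) ≠ B} → Fin N) := by
      refine
        { toFun := fun f B => f.1 B.1.out
          invFun := fun F => ⟨fun x => if h : ∃ a, J (e a) x then g h.choose else
            F ⟨Quotient.mk J x, fun a ha => h ⟨a, Quotient.exact ha⟩⟩, ?_, ?_⟩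
          left_inv := ?_
          right_inv := ?_ }
      · funext a
        have h : ∃ b, J (e b) (e a) := ⟨a, J.refl' _⟩
        simp only [Function.comp, dif_pos h]
        exact hg _ _ h.choose_spec
      · intro x y hxy
        by_cases h : ∃ a, J (e a) x
        · have h' : ∃ a, J (e a) y := h.imp fun a ha => J.trans' ha hxy
          simp only [dif_pos h, dif_pos h']
          exact hg _ _ (J.trans' h.choose_spec (J.trans' hxy (J.symm' h'.choose_spec)))
        · have h' : ¬ ∃ a, J (e a) y := fun h' => h (h'.imp fun a ha => J.trans' ha (J.symm' hxy))
          simp only [dif_neg h, dif_neg h']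
          congr 2
          exact Quotient.sound hxy
      · rintro ⟨f, hf, hJ⟩
        ext1
        funext x
        by_cases h : ∃ a, J (e a) x
        · simp only [dif_pos h]
          rw [← hf]
          exact hJ _ _ h.choose_spec
        · simp only [dif_neg h]
          exact hJ _ _ (Quotient.mk_out x)
      · intro F
        funext ⟨B, hB⟩
        have h : ¬ ∃ a, J (e a) B.out := by
          rintro ⟨a, ha⟩
          exact hB a (by rw [← Quotient.out_eq B]; exact Quotient.sound ha)
        simp only [dif_neg h, Quotient.out_eq]
    rw [← Fintype.card_subtype, ← Nat.card_eq_fintype_card, Nat.card_congr E, Nat.card_fun,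
      freeClasses, Nat.card_fin]
  · rw [Finset.card_eq_zero, Finset.filter_eq_empty_iff]
    rintro f - ⟨rfl, hf⟩
    exact hg fun a b hab => hf _ _ hab

/-! ### Matrices of setoids -/

/-- The indicator of the functions that are constant on the classes of `r`. -/
noncomputable def setoidVec (N : ℕ) {X : Type*} (r : Setoid X) : (X → Fin N) → ℂ :=
  fun f => if ConstOn r f then 1 else 0

/-- The matrix of a setoid on `k` upper and `l` lower points. -/
noncomputable def setoidMat (N : ℕ) {k l : ℕ} (r : Setoid (Fin k ⊕ Fin l)) : Mat N k l :=
  fun i j => setoidVec N r (Sum.elim j i)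

/-- The position of a point in the word formed by the upper points followed by the lower points
in reversed order. -/
def wordPos (k l : ℕ) : Fin k ⊕ Fin l → ℤ :=
  Sum.elim (fun a => (a : ℤ)) (fun b => (k : ℤ) + l - 1 - b)

@[simp] theorem wordPos_inl (k l : ℕ) (a : Fin k) : wordPos k l (.inl a) = a := rfl

@[simp] theorem wordPos_inr (k l : ℕ) (b : Fin l) :
    wordPos k l (.inr b) = (k : ℤ) + l - 1 - b := rfl

/-- Noncrossing setoids on `k` upper and `l` lower points. -/
def IsNC {k l : ℕ} (r : Setoid (Fin k ⊕ Fin l)) : Prop :=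
  NoncrossingOn (wordPos k l) r Set.univ

/-- The composition of two setoids as a setoid on the outer points together with two copies of
the middle points, the first `t` pairs of which are glued. -/
def glue {k l r : ℕ} (T : Setoid (Fin k ⊕ Fin l)) (S : Setoid (Fin l ⊕ Fin r)) :
    ∀ t, t ≤ l → Setoid ((Fin k ⊕ Fin l) ⊕ (Fin l ⊕ Fin r))
  | 0, _ => sumSetoid T S
  | t + 1, h => mergeSetoid (glue T S t (Nat.le_of_succ_le h)) (.inl (.inr ⟨t, h⟩))
      (.inr (.inl ⟨t, h⟩))

theorem constOn_glue {k l r : ℕ} {Y : Type*} (T : Setoid (Fin k ⊕ Fin l))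
    (S : Setoid (Fin l ⊕ Fin r)) (f : (Fin k ⊕ Fin l) ⊕ (Fin l ⊕ Fin r) → Y) :
    ∀ t (h : t ≤ l), ConstOn (glue T S t h) f ↔
      ConstOn T (f ∘ Sum.inl) ∧ ConstOn S (f ∘ Sum.inr) ∧
        ∀ b : Fin l, (b : ℕ) < t → f (.inl (.inr b)) = f (.inr (.inl b))
  | 0, _ => by simp [glue, constOn_sumSetoid]
  | t + 1, h => by
      rw [glue, constOn_mergeSetoid, constOn_glue T S f t]
      constructor
      · rintro ⟨⟨h1, h2, h3⟩, h4⟩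
        refine ⟨h1, h2, fun b hb => ?_⟩
        rcases Nat.lt_succ_iff_lt_or_eq.mp hb with hb | hb
        · exact h3 b hb
        · have : b = ⟨t, h⟩ := Fin.ext hb
          rw [this, h4]
      · rintro ⟨h1, h2, h3⟩
        exact ⟨⟨h1, h2, fun b hb => h3 b (by omega)⟩, h3 ⟨t, h⟩ (by simp)⟩

/-- The inclusion of the outer points of a composition. -/
def outer (k l r : ℕ) : Fin k ⊕ Fin r → (Fin k ⊕ Fin l) ⊕ (Fin l ⊕ Fin r) :=
  Sum.elim (fun a => .inl (.inl a)) (fun b => .inr (.inr b))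

/-- The composition of two setoids. -/
def compSetoid {k l r : ℕ} (S : Setoid (Fin l ⊕ Fin r)) (T : Setoid (Fin k ⊕ Fin l)) :
    Setoid (Fin k ⊕ Fin r) :=
  Setoid.comap (outer k l r) (glue T S l le_rfl)

theorem setoidMat_mul (N : ℕ) {k l r : ℕ} (S : Setoid (Fin l ⊕ Fin r))
    (T : Setoid (Fin k ⊕ Fin l)) :
    setoidMat N S * setoidMat N T =
      ((N ^ freeClasses (outer k l r) (glue T S l le_rfl) : ℕ) : ℂ) •
        setoidMat N (compSetoid S T) := by
  ext i j
  have h := card_constOn (N := N) (outer k l r) (glue T S l le_rfl) (Sum.elim j i)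
  have h' : (Finset.univ.filter fun f : (Fin k ⊕ Fin l) ⊕ (Fin l ⊕ Fin r) → Fin N =>
      f ∘ outer k l r = Sum.elim j i ∧ ConstOn (glue T S l le_rfl) f).card =
      (Finset.univ.filter fun m : Fin l → Fin N =>
        ConstOn S (Sum.elim m i) ∧ ConstOn T (Sum.elim j m)).card := by
    symm
    refine Finset.card_bij' (fun m _ => Sum.elim (Sum.elim j m) (Sum.elim m i))
      (fun f _ b => f (.inl (.inr b))) ?_ ?_ ?_ ?_
    · intro m hm
      simp only [Finset.mem_filter, Finset.mem_univ, true_and] at hm ⊢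
      refine ⟨by ext (a | a) <;> rfl, ?_⟩
      rw [constOn_glue]
      exact ⟨hm.2, hm.1, fun b _ => rfl⟩
    · intro f hf
      simp only [Finset.mem_filter, Finset.mem_univ, true_and] at hf ⊢
      obtain ⟨h1, h2⟩ := hf
      rw [constOn_glue] at h2
      obtain ⟨h2, h3, h4⟩ := h2
      have hj : ∀ a, f (.inl (.inl a)) = j a := fun a => congrFun h1 (.inl a)
      have hi : ∀ a, f (.inr (.inr a)) = i a := fun a => congrFun h1 (.inr a)
      constructor
      · convert h3 using 1
        ext (b | b)
        · simp [h4 b b.2]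
        · simp [hi]
      · convert h2 using 1
        ext (b | b)
        · simp [hj]
        · simp
    · intro m _
      rfl
    · intro f hf
      simp only [Finset.mem_filter, Finset.mem_univ, true_and] at hf
      obtain ⟨h1, h2⟩ := hf
      rw [constOn_glue] at h2
      have hj : ∀ a, f (.inl (.inl a)) = j a := fun a => congrFun h1 (.inl a)
      have hi : ∀ a, f (.inr (.inr a)) = i a := fun a => congrFun h1 (.inr a)
      ext ((b | b) | (b | b))
      · simp [hj]
      · simp
      · simp [h2.2.2 b b.2]
      · simp [hi]
  replace h := h'.symm.trans (Eq.trans (by congr!) h)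
  have h2 : (setoidMat N S * setoidMat N T) i j =
      ((Finset.univ.filter fun m : Fin l → Fin N =>
        ConstOn S (Sum.elim m i) ∧ ConstOn T (Sum.elim j m)).card : ℂ) := by
    rw [Matrix.mul_apply, Finset.card_filter]
    push_cast
    refine Finset.sum_congr rfl fun m _ => ?_
    simp only [setoidMat, setoidVec]
    split_ifs <;> simp_all
  rw [h2, h, Matrix.smul_apply, setoidMat, setoidVec, compSetoid]
  split_ifs <;> simp

theorem IsNC.comp {k l r : ℕ} {S : Setoid (Fin l ⊕ Fin r)} {T : Setoid (Fin k ⊕ Fin l)}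
    (hS : IsNC S) (hT : IsNC T) : IsNC (compSetoid S T) := by
  let pos : (Fin k ⊕ Fin l) ⊕ (Fin l ⊕ Fin r) → ℤ :=
    Sum.elim (fun x => wordPos k l x - (k + l)) (wordPos l r)
  have h : ∀ t (h : t ≤ l), NoncrossingOn pos (glue T S t h)
      {x | pos x < -t ∨ (t : ℤ) ≤ pos x} := by
    intro t
    induction t with
    | zero =>
      intro _
      refine (NoncrossingOn.sumSetoid (pos := pos) ?_ hS ?_).mono (Set.subset_univ _)
      · exact fun a b c d _ _ _ _ hab hbc hcd => hT trivial trivial trivial trivial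
          (by simpa [pos] using hab) (by simpa [pos] using hbc) (by simpa [pos] using hcd)
      · rintro (x | x) (y | y) (z | z) <;> simp [pos] <;> omega
    | succ t ih =>
      intro h
      refine ((ih (Nat.le_of_succ_le h)).mergeSetoid ?_ ?_ ?_ ?_).mono ?_
      · simp [pos]; omega
      · simp [pos]
      · simp [pos]; omega
      · rintro ((z | z) | (z | z)) <;> simp [pos, Fin.ext_iff] <;> omega
      · intro x hx
        simp only [Set.mem_ofPred_eq] at hx ⊢
        omega
  refine (h l le_rfl).comap ?_ ?_
  · rintro (y | y) <;> simp [pos, outer] <;> omega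
  · rintro (y | y) (z | z) <;> simp [pos, outer] <;> omega

/-- The rearrangement of points identifying the tensor product of two setoids with their disjoint
union. -/
def tensorPoints (k l k' l' : ℕ) :
    Fin (k + k') ⊕ Fin (l + l') → (Fin k ⊕ Fin l) ⊕ (Fin k' ⊕ Fin l') :=
  Sum.elim (Fin.append (fun a => .inl (.inl a)) (fun a => .inr (.inl a)))
    (Fin.append (fun a => .inl (.inr a)) (fun a => .inr (.inr a)))

/-- The tensor product of two setoids. -/
def tensorSetoid {k l k' l' : ℕ} (S : Setoid (Fin k ⊕ Fin l)) (T : Setoid (Fin k' ⊕ Fin l')) :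
    Setoid (Fin (k + k') ⊕ Fin (l + l')) :=
  Setoid.comap (tensorPoints k l k' l') (sumSetoid S T)

theorem tensorMat_setoidMat (N : ℕ) {k l k' l' : ℕ} (S : Setoid (Fin k ⊕ Fin l))
    (T : Setoid (Fin k' ⊕ Fin l')) :
    tensorMat (setoidMat N S) (setoidMat N T) = setoidMat N (tensorSetoid S T) := by
  ext i j
  let f : (Fin k ⊕ Fin l) ⊕ (Fin k' ⊕ Fin l') → Fin N :=
    Sum.elim (Sum.elim (fun b => j (Fin.castAdd k' b)) (fun a => i (Fin.castAdd l' a)))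
      (Sum.elim (fun b => j (Fin.natAdd k b)) (fun a => i (Fin.natAdd l a)))
  have hf : f ∘ tensorPoints k l k' l' = Sum.elim j i := by
    ext (a | a) <;> refine Fin.addCases (fun a => ?_) (fun a => ?_) a <;>
      simp [f, tensorPoints]
  have hsurj : Function.Surjective (tensorPoints k l k' l') := by
    rintro ((a | a) | (a | a))
    · exact ⟨.inl (Fin.castAdd _ a), by simp [tensorPoints]⟩
    · exact ⟨.inr (Fin.castAdd _ a), by simp [tensorPoints]⟩
    · exact ⟨.inl (Fin.natAdd _ a), by simp [tensorPoints]⟩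
    · exact ⟨.inr (Fin.natAdd _ a), by simp [tensorPoints]⟩
  have h : ConstOn (tensorSetoid S T) (Sum.elim j i) ↔
      ConstOn S (f ∘ Sum.inl) ∧ ConstOn T (f ∘ Sum.inr) := by
    rw [← hf, ← constOn_sumSetoid]
    constructor
    · intro h x y hxy
      obtain ⟨x, rfl⟩ := hsurj x
      obtain ⟨y, rfl⟩ := hsurj y
      exact h x y hxy
    · exact fun h x y hxy => h _ _ hxy
  have h1 : f ∘ Sum.inl =
    Sum.elim (fun b => j (Fin.castAdd k' b)) (fun a => i (Fin.castAdd l' a)) := rfl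
  have h2 : f ∘ Sum.inr =
    Sum.elim (fun b => j (Fin.natAdd k b)) (fun a => i (Fin.natAdd l a)) := rfl
  rw [h1, h2] at h
  simp only [tensorMat, setoidMat, setoidVec, h]
  split_ifs <;> simp_all

theorem IsNC.tensor {k l k' l' : ℕ} {S : Setoid (Fin k ⊕ Fin l)}
    {T : Setoid (Fin k' ⊕ Fin l')} (hS : IsNC S) (hT : IsNC T) : IsNC (tensorSetoid S T) := by
  let pos : (Fin k ⊕ Fin l) ⊕ (Fin k' ⊕ Fin l') → ℤ :=
    Sum.elim (Sum.elim (fun a => (a : ℤ)) (fun b => (k : ℤ) + k' + l' + l - 1 - b))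
      (fun x => k + wordPos k' l' x)
  refine NoncrossingOn.comap (pos := pos) (A := Set.univ) (.sumSetoid ?_ ?_ ?_)
    (fun _ => trivial) ?_
  · have : ∀ x y, pos (.inl x) < pos (.inl y) → wordPos k l x < wordPos k l y := by
      rintro (x | x) (y | y) <;> simp [pos] <;> omega
    exact fun a b c d _ _ _ _ hab hbc hcd => hS trivial trivial trivial trivial
      (this _ _ hab) (this _ _ hbc) (this _ _ hcd)
  · exact fun a b c d _ _ _ _ hab hbc hcd => hT trivial trivial trivial trivial
      (by simpa [pos] using hab) (by simpa [pos] using hbc) (by simpa [pos] using hcd)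
  · rintro (x | x) (y | y) (z | z) <;> simp [pos] <;> omega
  · rintro (x | x) (y | y) <;> refine Fin.addCases (fun x => ?_) (fun x => ?_) x <;>
      refine Fin.addCases (fun y => ?_) (fun y => ?_) y <;>
      simp [pos, tensorPoints] <;> omega

theorem setoidMat_conjTranspose (N : ℕ) {k l : ℕ} (r : Setoid (Fin k ⊕ Fin l)) :
    (setoidMat N r).conjTranspose = setoidMat N (Setoid.comap Sum.swap r) := by
  ext i j
  have h : ConstOn r (Sum.elim i j) ↔ ConstOn (Setoid.comap Sum.swap r) (Sum.elim j i) := by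
    have : Sum.elim j i = Sum.elim i j ∘ Sum.swap := by ext (a | a) <;> rfl
    rw [this]
    constructor
    · exact fun h x y hxy => h _ _ hxy
    · intro h x y hxy
      have := h x.swap y.swap (by simpa [Setoid.comap_rel] using hxy)
      simpa using this
  simp only [Matrix.conjTranspose_apply, setoidMat, setoidVec, h]
  split_ifs <;> simp

theorem IsNC.swap {k l : ℕ} {r : Setoid (Fin k ⊕ Fin l)} (hr : IsNC r) :
    IsNC (Setoid.comap Sum.swap r) := by
  intro a b c d _ _ _ _ hab hbc hcd hac hbd
  have : ∀ x y, wordPos l k x < wordPos l k y → wordPos k l y.swap < wordPos k l x.swap := by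
    rintro (x | x) (y | y) <;> simp <;> omega
  have h := hr (a := d.swap) (b := c.swap) (c := b.swap) (d := a.swap) trivial trivial trivial
    trivial (this _ _ hcd) (this _ _ hbc) (this _ _ hab) (r.symm' hbd) (r.symm' hac)
  exact r.trans' hac (r.trans' (r.symm' h) (r.symm' hbd))

theorem isNC_top {k l : ℕ} : IsNC (⊤ : Setoid (Fin k ⊕ Fin l)) :=
  fun _ _ _ _ _ _ _ _ _ _ _ _ _ => trivial

theorem setoidMat_top_one (N : ℕ) :
    setoidMat N (⊤ : Setoid (Fin 1 ⊕ Fin 1)) = 1 := by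
  ext i j
  have : ConstOn (⊤ : Setoid (Fin 1 ⊕ Fin 1)) (Sum.elim j i) ↔ i = j := by
    constructor
    · intro h
      ext a
      rw [Subsingleton.elim a 0]
      exact congrArg _ (h (.inr 0) (.inl 0) trivial)
    · rintro rfl (x | x) (y | y) _ <;> simp [Subsingleton.elim x 0, Subsingleton.elim y 0]
  simp [setoidMat, setoidVec, this, Matrix.one_apply]

theorem setoidMat_top_cup (N : ℕ) :
    setoidMat N (⊤ : Setoid (Fin 2 ⊕ Fin 0)) = cupMat N := by
  ext i j
  have : ConstOn (⊤ : Setoid (Fin 2 ⊕ Fin 0)) (Sum.elim j i) ↔ j 0 = j 1 := by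
    constructor
    · exact fun h => h (.inl 0) (.inl 1) trivial
    · rintro h (x | x) (y | y) _
      · fin_cases x <;> fin_cases y <;> simp [h]
      all_goals first | exact x.elim0 | exact y.elim0
  simp [setoidMat, setoidVec, this, cupMat]

/-- The Tannaka–Krein dual spanned by the matrices of a class of setoids that is closed under
tensor products, composition and adjoints and contains the setoids with one class. -/
noncomputable def TKDual.ofSetoids (N : ℕ) (G : ∀ {k l : ℕ}, Setoid (Fin k ⊕ Fin l) → Prop)
    (htensor : ∀ {k l k' l' : ℕ} {S : Setoid (Fin k ⊕ Fin l)} {T : Setoid (Fin k' ⊕ Fin l')},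
      G S → G T → G (tensorSetoid S T))
    (hcomp : ∀ {k l r : ℕ} {S : Setoid (Fin l ⊕ Fin r)} {T : Setoid (Fin k ⊕ Fin l)},
      G S → G T → G (compSetoid S T))
    (hadj : ∀ {k l : ℕ} {S : Setoid (Fin k ⊕ Fin l)}, G S → G (Setoid.comap Sum.swap S))
    (htop : ∀ {k l : ℕ}, G (⊤ : Setoid (Fin k ⊕ Fin l))) : TKDual N where
  C k l := Submodule.span ℂ {T | ∃ r : Setoid (Fin k ⊕ Fin l), G r ∧ T = setoidMat N r}
  tensor_mem := by
    intro k l k' l' S T hS hT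
    induction hS, hT using Submodule.span_induction₂ with
    | mem_mem x y hx hy =>
      obtain ⟨r, hr, rfl⟩ := hx
      obtain ⟨s, hs, rfl⟩ := hy
      exact Submodule.subset_span ⟨_, htensor hr hs, tensorMat_setoidMat N r s⟩
    | zero_left y hy =>
      convert Submodule.zero_mem _ using 1
      ext i j
      simp [tensorMat]
    | zero_right y hy =>
      convert Submodule.zero_mem _ using 1
      ext i j
      simp [tensorMat]
    | add_left x y z _ _ _ h1 h2 =>
      convert Submodule.add_mem _ h1 h2 using 1
      ext i j
      simp [tensorMat, add_mul]
    | add_right x y z _ _ _ h1 h2 =>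
      convert Submodule.add_mem _ h1 h2 using 1
      ext i j
      simp [tensorMat, mul_add]
    | smul_left c x y _ _ h =>
      convert Submodule.smul_mem _ c h using 1
      ext i j
      simp [tensorMat, mul_assoc]
    | smul_right c x y _ _ h =>
      convert Submodule.smul_mem _ c h using 1
      ext i j
      simp [tensorMat, mul_left_comm]
  comp_mem := by
    intro k l r S T hS hT
    induction hS, hT using Submodule.span_induction₂ with
    | mem_mem x y hx hy =>
      obtain ⟨r, hr, rfl⟩ := hx
      obtain ⟨s, hs, rfl⟩ := hy
      rw [setoidMat_mul]
      exact Submodule.smul_mem _ _ (Submodule.subset_span ⟨_, hcomp hr hs, rfl⟩)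
    | zero_left y hy => simp
    | zero_right y hy => simp
    | add_left x y z _ _ _ h1 h2 =>
      rw [Matrix.add_mul]
      exact Submodule.add_mem _ h1 h2
    | add_right x y z _ _ _ h1 h2 =>
      rw [Matrix.mul_add]
      exact Submodule.add_mem _ h1 h2
    | smul_left c x y _ _ h =>
      rw [Matrix.smul_mul]
      exact Submodule.smul_mem _ c h
    | smul_right c x y _ _ h =>
      rw [Matrix.mul_smul]
      exact Submodule.smul_mem _ c h
  adj_mem := by
    intro k l T hT
    induction hT using Submodule.span_induction with
    | mem x hx =>
      obtain ⟨r, hr, rfl⟩ := hx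
      exact Submodule.subset_span ⟨_, hadj hr, setoidMat_conjTranspose N r⟩
    | zero => simp
    | add x y _ _ hx hy =>
      rw [Matrix.conjTranspose_add]
      exact Submodule.add_mem _ hx hy
    | smul c x _ hx =>
      rw [Matrix.conjTranspose_smul]
      exact Submodule.smul_mem _ _ hx
  id_mem := Submodule.subset_span ⟨⊤, htop, (setoidMat_top_one N).symm⟩
  cup_mem := Submodule.subset_span ⟨⊤, htop, (setoidMat_top_cup N).symm⟩

/-! ### Partitions and setoids -/

/-- The setoid of a partition. -/
def partSetoid {n : ℕ} (p : Finpartition (Finset.univ : Finset (Fin n))) : Setoid (Fin n) where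
  r := PartRel p
  iseqv := by
    refine ⟨fun x => ?_, ?_, ?_⟩
    · obtain ⟨B, hB, hx⟩ := p.exists_mem (Finset.mem_univ x)
      exact ⟨B, hB, hx, hx⟩
    · rintro x y ⟨B, hB, hx, hy⟩
      exact ⟨B, hB, hy, hx⟩
    · rintro x y z ⟨B, hB, hx, hy⟩ ⟨B', hB', hy', hz⟩
      obtain rfl := p.eq_of_mem_parts hB hB' hy hy'
      exact ⟨B, hB, hx, hz⟩

theorem partSetoid_apply {n : ℕ} (p : Finpartition (Finset.univ : Finset (Fin n)))
    (x y : Fin n) : partSetoid p x y ↔ PartRel p x y := Iff.rfl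

theorem partSetoid_surjective {n : ℕ} (s : Setoid (Fin n)) : ∃ p, partSetoid p = s := by
  refine ⟨Finpartition.ofSetoid s, ?_⟩
  ext x y
  rw [← Finpartition.mem_part_ofSetoid_iff_rel (s := s), partSetoid_apply,
    Finpartition.mem_part_iff_exists]
  exact ⟨fun ⟨B, hB, hx, hy⟩ => ⟨B, hB, hy, hx⟩, fun ⟨B, hB, hx, hy⟩ => ⟨B, hB, hy, hx⟩⟩

theorem partSetoid_injective {n : ℕ} {p q : Finpartition (Finset.univ : Finset (Fin n))}
    (h : partSetoid p = partSetoid q) : p = q := by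
  have key : ∀ p q : Finpartition (Finset.univ : Finset (Fin n)),
      partSetoid p = partSetoid q → p.parts ⊆ q.parts := by
    intro p q h B hB
    obtain ⟨x, hx⟩ := p.nonempty_of_mem_parts hB
    obtain ⟨B', hB', hx'⟩ := q.exists_mem (Finset.mem_univ x)
    have : B = B' := by
      ext y
      constructor
      · intro hy
        have : partSetoid q x y := h ▸ (⟨B, hB, hx, hy⟩ : partSetoid p x y)
        obtain ⟨B₂, hB₂, hx₂, hy₂⟩ := this
        rwa [q.eq_of_mem_parts hB' hB₂ hx' hx₂]
      · intro hy
        have : partSetoid p x y := h ▸ (⟨B', hB', hx', hy⟩ : partSetoid q x y)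
        obtain ⟨B₂, hB₂, hx₂, hy₂⟩ := this
        rwa [p.eq_of_mem_parts hB hB₂ hx hx₂]
    rwa [this]
  exact Finpartition.ext (Finset.Subset.antisymm (key p q h) (key q p h.symm))

theorem xi_eq_setoidVec (N : ℕ) {k : ℕ} (p : Finpartition (Finset.univ : Finset (Fin k))) :
    xi N p = setoidVec N (partSetoid p) := by
  ext f
  simp only [xi, setoidVec, ConstOn, partSetoid_apply]

/-- The setoid on upper and lower points of a partition of `[k + l]`. -/
def twoLineSetoid {k l : ℕ} (p : Finpartition (Finset.univ : Finset (Fin (k + l)))) :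
    Setoid (Fin k ⊕ Fin l) :=
  Setoid.comap finSumFinEquiv (partSetoid p)

theorem twoLineSetoid_surjective {k l : ℕ} (s : Setoid (Fin k ⊕ Fin l)) :
    ∃ p, twoLineSetoid p = s := by
  obtain ⟨p, hp⟩ := partSetoid_surjective (Setoid.comap finSumFinEquiv.symm s)
  refine ⟨p, ?_⟩
  rw [twoLineSetoid, hp]
  ext x y
  rw [Setoid.comap_rel, Setoid.comap_rel, Equiv.symm_apply_apply, Equiv.symm_apply_apply]

theorem Tmat_eq_setoidMat (N k l : ℕ) (p : Finpartition (Finset.univ : Finset (Fin (k + l)))) :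
    Tmat N k l p = setoidMat N (twoLineSetoid p) := by
  ext i j
  have h : ∀ x, Fin.append j i (finSumFinEquiv x) = Sum.elim j i x := by
    rintro (x | x) <;> simp
  have : (∀ x y, PartRel p x y → Fin.append j i x = Fin.append j i y) ↔
      ConstOn (twoLineSetoid p) (Sum.elim j i) := by
    constructor
    · intro H x y hxy
      rw [← h, ← h]
      exact H _ _ hxy
    · intro H x y hxy
      obtain ⟨x, rfl⟩ := finSumFinEquiv.surjective x
      obtain ⟨y, rfl⟩ := finSumFinEquiv.surjective y
      rw [h, h]
      exact H _ _ hxy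
  simp only [Tmat, setoidMat, setoidVec, this]

theorem isNCPart_iff {k l : ℕ} (p : Finpartition (Finset.univ : Finset (Fin (k + l)))) :
    IsNCPart p ↔ IsNC (twoLineSetoid p) := by
  let e : Fin k ⊕ Fin l → Fin (k + l) :=
    Sum.elim (Fin.castAdd l) (fun b => Fin.natAdd k b.rev)
  have he : ∀ x, lowerRev k l (e x) = finSumFinEquiv x := by
    rintro (x | x) <;> simp [e, lowerRev]
  have hsurj : Function.Surjective e := by
    intro x
    refine Fin.addCases (fun a => ⟨.inl a, rfl⟩) (fun b => ⟨.inr b.rev, ?_⟩) x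
    simp [e]
  have hlt : ∀ x y, e x < e y ↔ wordPos k l x < wordPos k l y := by
    rintro (x | x) (y | y) <;> simp only [e, Sum.elim_inl, Sum.elim_inr, Fin.lt_def,
      Fin.val_rev, Fin.val_castAdd, Fin.val_natAdd, wordPos_inl, wordPos_inr] <;> omega
  have hrel : ∀ x y, PartRel p (lowerRev k l (e x)) (lowerRev k l (e y)) ↔
      twoLineSetoid p x y := by
    intro x y
    rw [he, he]
    rfl
  constructor
  · intro h a b c d _ _ _ _ hab hbc hcd hac hbd
    by_contra hab'
    refine h _ ⟨e a, e b, e c, e d, (hlt _ _).2 hab, (hlt _ _).2 hbc, (hlt _ _).2 hcd, rfl,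
      (hrel _ _).2 hac, (hrel _ _).2 hbd, fun h => hab' ((hrel _ _).1 h)⟩
  · rintro h _ ⟨a, b, c, d, hab, hbc, hcd, -, hac, hbd, hn⟩
    obtain ⟨a, rfl⟩ := hsurj a
    obtain ⟨b, rfl⟩ := hsurj b
    obtain ⟨c, rfl⟩ := hsurj c
    obtain ⟨d, rfl⟩ := hsurj d
    rw [hlt] at hab hbc hcd
    exact hn ((hrel _ _).2 (h trivial trivial trivial trivial hab hbc hcd ((hrel _ _).1 hac)
      ((hrel _ _).1 hbd)))

/-- The family `P` as a Tannaka–Krein dual. -/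
noncomputable def allDual (N : ℕ) : TKDual N :=
  TKDual.ofSetoids N (fun _ => True) (fun _ _ => trivial) (fun _ _ => trivial) (fun _ => trivial)
    trivial

/-- The family `NC` as a Tannaka–Krein dual. -/
noncomputable def ncDual (N : ℕ) : TKDual N :=
  TKDual.ofSetoids N IsNC IsNC.tensor IsNC.comp IsNC.swap @isNC_top

theorem allDual_C (N k l : ℕ) : (allDual N).C k l = Pfam N k l := by
  refine congrArg (Submodule.span ℂ) (Set.ext fun T => ?_)
  constructor
  · rintro ⟨r, -, rfl⟩
    obtain ⟨p, rfl⟩ := twoLineSetoid_surjective r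
    exact ⟨p, Tmat_eq_setoidMat N k l p⟩
  · rintro ⟨p, rfl⟩
    exact ⟨_, trivial, Tmat_eq_setoidMat N k l p⟩

theorem ncDual_C (N k l : ℕ) : (ncDual N).C k l = NCfam N k l := by
  refine congrArg (Submodule.span ℂ) (Set.ext fun T => ?_)
  constructor
  · rintro ⟨r, hr, rfl⟩
    obtain ⟨p, rfl⟩ := twoLineSetoid_surjective r
    exact ⟨p, (isNCPart_iff p).2 hr, (Tmat_eq_setoidMat N k l p).symm⟩
  · rintro ⟨p, hp, rfl⟩
    exact ⟨_, (isNCPart_iff p).1 hp, Tmat_eq_setoidMat N k l p⟩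

theorem setoidMat_mem_Pfam (N : ℕ) {k l : ℕ} (r : Setoid (Fin k ⊕ Fin l)) :
    setoidMat N r ∈ Pfam N k l := by
  rw [← allDual_C]
  exact Submodule.subset_span ⟨r, trivial, rfl⟩

theorem setoidMat_mem_NCfam (N : ℕ) {k l : ℕ} {r : Setoid (Fin k ⊕ Fin l)} (hr : IsNC r) :
    setoidMat N r ∈ NCfam N k l := by
  rw [← ncDual_C]
  exact Submodule.subset_span ⟨r, hr, rfl⟩

theorem NCfam_le_Pfam (N k l : ℕ) : NCfam N k l ≤ Pfam N k l :=
  Submodule.span_mono (by rintro _ ⟨p, -, rfl⟩; exact ⟨p, rfl⟩)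

/-- A setoid on `k` points viewed as a setoid on no upper and `k` lower points. -/
def vecSetoid {k : ℕ} (r : Setoid (Fin k)) : Setoid (Fin 0 ⊕ Fin k) :=
  Setoid.comap (Sum.elim Fin.elim0 id) r

theorem vecMat_setoidVec (N : ℕ) {k : ℕ} (r : Setoid (Fin k)) :
    vecMat (setoidVec N r) = setoidMat N (vecSetoid r) := by
  ext i j
  have : ConstOn r i ↔ ConstOn (vecSetoid r) (Sum.elim j i) := by
    constructor
    · rintro h (x | x) (y | y) hxy
      · exact x.elim0
      · exact x.elim0
      · exact y.elim0
      · exact h _ _ hxy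
    · exact fun h x y hxy => h (.inr x) (.inr y) hxy
  simp only [vecMat, setoidMat, setoidVec, this]

/-- `r` has a crossing at `a < b < c < d`. -/
def CrossAt {n : ℕ} (r : Setoid (Fin n)) (a b c d : Fin n) : Prop :=
  a < b ∧ b < c ∧ c < d ∧ r a c ∧ r b d ∧ ¬ r a b

theorem isNC_vecSetoid {k : ℕ} {r : Setoid (Fin k)} (h : ∀ a b c d, ¬ CrossAt r a b c d) :
    IsNC (vecSetoid r) := by
  rintro (a | a) (b | b) (c | c) (d | d) _ _ _ _ hab hbc hcd hac hbd
  all_goals try exact Fin.elim0 (by assumption)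
  by_contra hab'
  have hac' : r a c := hac
  have hbd' : r b d := hbd
  refine h d c b a ⟨?_, ?_, ?_, r.symm' hbd', r.symm' hac', fun hdc => hab' ?_⟩
  · simp at hcd; exact hcd
  · simp at hbc; exact hbc
  · simp at hab; exact hab
  · exact r.trans' hac' (r.trans' (r.symm' hdc) (r.symm' hbd'))

/-! ### The crossing generates all partitions -/

/-- The kernel of labels that increase along the upper and along the lower points is
noncrossing. -/
theorem isNC_ker_of_monotone {k l : ℕ} {g : Fin k → ℕ} {h : Fin l → ℕ} (hg : Monotone g)
    (hh : Monotone h) : IsNC (Setoid.ker (Sum.elim g h)) := by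
  refine noncrossingOn_ker_of_unimodal ?_
  rintro (a | a) (b | b) (c | c) hab hbc <;> simp at hab hbc ⊢
  · exact Or.inl (hg hab.le)
  · exact Or.inl (hg hab.le)
  · omega
  · exact Or.inr (hh hbc.le)
  · omega
  · omega
  · omega
  · exact Or.inr (hh hbc.le)

/-- The matrix permuting the tensor factors by `σ`. -/
noncomputable def permMat (N : ℕ) {k : ℕ} (σ : Equiv.Perm (Fin k)) : Mat N k k :=
  fun i j => if i = j ∘ σ then 1 else 0

theorem permMat_mul (N : ℕ) {k : ℕ} (σ τ : Equiv.Perm (Fin k)) :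
    permMat N σ * permMat N τ = permMat N (τ * σ) := by
  ext i j
  rw [Matrix.mul_apply, Finset.sum_eq_single (j ∘ τ)]
  · by_cases h : i = (j ∘ τ) ∘ σ <;>
      simp_all [permMat, Function.comp_assoc]
  · intro m _ hm
    simp [permMat, hm]
  · simp

theorem permMat_one (N k : ℕ) : permMat N (1 : Equiv.Perm (Fin k)) = 1 := by
  ext i j
  simp [permMat, Matrix.one_apply]

theorem one_mem_NCfam (N k : ℕ) :
    (1 : Matrix (Fin k → Fin N) (Fin k → Fin N) ℂ) ∈ NCfam N k k := by
  have hr : IsNC (Setoid.ker (Sum.elim (fun a : Fin k => (a : ℕ)) (fun a : Fin k => (a : ℕ)))) :=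
    isNC_ker_of_monotone (fun _ _ h => h) (fun _ _ h => h)
  convert setoidMat_mem_NCfam N hr using 1
  ext i j
  have : i = j ↔ ConstOn (Setoid.ker (Sum.elim (fun a : Fin k => (a : ℕ))
      (fun a : Fin k => (a : ℕ)))) (Sum.elim j i) := by
    constructor
    · rintro rfl (x | x) (y | y) hxy <;>
        · rw [Setoid.ker_def] at hxy
          simp [Fin.ext hxy]
    · intro h
      ext a
      exact congrArg _ (h (.inr a) (.inl a) (by simp [Setoid.ker_def]))
  simp only [Matrix.one_apply, setoidMat, setoidVec, this]

theorem permMat_swap_mem {N : ℕ} (C : TKDual N) (hNC : ∀ a b, NCfam N a b ≤ C.C a b)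
    (hX : permMat N (Equiv.swap (0 : Fin 2) 1) ∈ C.C 2 2) {m a b : ℕ} (h : m = a + 2 + b) :
    permMat N (Equiv.swap (⟨a, by omega⟩ : Fin m) ⟨a + 1, by omega⟩) ∈ C.C m m := by
  subst h
  have h1 := C.tensor_mem (C.tensor_mem (hNC _ _ (one_mem_NCfam N a)) hX)
    (hNC _ _ (one_mem_NCfam N b))
  convert h1 using 1
  ext i j
  have : i = j ∘ Equiv.swap (⟨a, by omega⟩ : Fin (a + 2 + b)) ⟨a + 1, by omega⟩ ↔
      ((fun t => i (Fin.castAdd b (Fin.castAdd 2 t))) =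
        (fun t => j (Fin.castAdd b (Fin.castAdd 2 t))) ∧
      (fun t => i (Fin.castAdd b (Fin.natAdd a t))) =
        (fun t => j (Fin.castAdd b (Fin.natAdd a t))) ∘ Equiv.swap (0 : Fin 2) 1) ∧
      (fun t => i (Fin.natAdd (a + 2) t)) = (fun t => j (Fin.natAdd (a + 2) t)) := by
    have e0 : (⟨a, by omega⟩ : Fin (a + 2 + b)) = Fin.castAdd b (Fin.natAdd a 0) := rfl
    have e1 : (⟨a + 1, by omega⟩ : Fin (a + 2 + b)) = Fin.castAdd b (Fin.natAdd a 1) := rfl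
    have s1 : ∀ t : Fin a, Equiv.swap (⟨a, by omega⟩ : Fin (a + 2 + b)) ⟨a + 1, by omega⟩
        (Fin.castAdd b (Fin.castAdd 2 t)) = Fin.castAdd b (Fin.castAdd 2 t) := fun t =>
      Equiv.swap_apply_of_ne_of_ne (by simp [Fin.ext_iff]; omega) (by simp [Fin.ext_iff]; omega)
    have s2 : ∀ t : Fin b, Equiv.swap (⟨a, by omega⟩ : Fin (a + 2 + b)) ⟨a + 1, by omega⟩
        (Fin.natAdd (a + 2) t) = Fin.natAdd (a + 2) t := fun t =>
      Equiv.swap_apply_of_ne_of_ne (by simp [Fin.ext_iff]; omega) (by simp [Fin.ext_iff]; omega)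
    constructor
    · intro h
      refine ⟨⟨?_, ?_⟩, ?_⟩
      · funext t
        rw [h, Function.comp, s1]
      · funext t
        rw [h]
        fin_cases t
        · simp [e0, e1]
        · simp [e0, e1]
      · funext t
        rw [h, Function.comp, s2]
    · rintro ⟨⟨h1, h2⟩, h3⟩
      funext t
      refine Fin.addCases (fun t => ?_) (fun t => ?_) t
      · refine Fin.addCases (fun t => ?_) (fun t => ?_) t
        · rw [Function.comp, s1]
          exact congrFun h1 t
        · have := congrFun h2 t
          fin_cases t
          · simpa [e0, e1] using this
          · simpa [e0, e1] using this
      · rw [Function.comp, s2]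
        exact congrFun h3 t
  simp only [tensorMat, permMat, this, Matrix.one_apply]
  split_ifs <;> simp_all

theorem permMat_mem {N : ℕ} (C : TKDual N) (hNC : ∀ a b, NCfam N a b ≤ C.C a b)
    (hX : permMat N (Equiv.swap (0 : Fin 2) 1) ∈ C.C 2 2) {k : ℕ} (σ : Equiv.Perm (Fin k)) :
    permMat N σ ∈ C.C k k := by
  rcases k with _ | k
  · rw [Subsingleton.elim σ 1, permMat_one]
    exact hNC _ _ (one_mem_NCfam N 0)
  · have hσ : σ ∈ Submonoid.closure
        (Set.range fun i : Fin k => Equiv.swap i.castSucc i.succ) := by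
      rw [Equiv.Perm.mclosure_swap_castSucc_succ]
      trivial
    induction hσ using Submonoid.closure_induction with
    | mem x hx =>
      obtain ⟨i, rfl⟩ := hx
      exact permMat_swap_mem C hNC hX (a := i) (b := k - 1 - i) (by omega)
    | one =>
      rw [permMat_one]
      exact hNC _ _ (one_mem_NCfam N _)
    | mul x y _ _ hx hy =>
      rw [← permMat_mul]
      exact C.comp_mem hy hx

theorem setoidMat_eq_perm_mul (N : ℕ) {k l : ℕ} (r : Setoid (Fin k ⊕ Fin l))
    (σ : Equiv.Perm (Fin k)) (τ : Equiv.Perm (Fin l)) :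
    setoidMat N r = permMat N τ⁻¹ * setoidMat N (Setoid.comap (Sum.map σ τ) r) * permMat N σ := by
  ext i j
  rw [Matrix.mul_apply, Finset.sum_eq_single (j ∘ σ), Matrix.mul_apply,
    Finset.sum_eq_single (i ∘ τ)]
  · have h : ConstOn (Setoid.comap (Sum.map σ τ) r) (Sum.elim (j ∘ σ) (i ∘ τ)) ↔
        ConstOn r (Sum.elim j i) := by
      rw [← Sum.elim_comp_map]
      constructor
      · intro h x y hxy
        obtain ⟨x, rfl⟩ := (Equiv.sumCongr σ τ).surjective x
        obtain ⟨y, rfl⟩ := (Equiv.sumCongr σ τ).surjective y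
        exact h x y hxy
      · exact fun h x y hxy => h _ _ hxy
    have hi : i = (i ∘ τ) ∘ ⇑τ⁻¹ := by ext; simp
    simp only [permMat, setoidMat, setoidVec, h, ← hi, if_true, one_mul, mul_one]
  · intro m _ hm
    have : i ≠ m ∘ ⇑τ⁻¹ := by
      rintro rfl
      exact hm (by ext; simp)
    rw [permMat, if_neg this, zero_mul]
  · simp
  · intro m _ hm
    simp [permMat, hm]
  · simp

theorem Pfam_le_of_swap_mem {N : ℕ} (C : TKDual N) (hNC : ∀ a b, NCfam N a b ≤ C.C a b)
    (hX : permMat N (Equiv.swap (0 : Fin 2) 1) ∈ C.C 2 2) (k l : ℕ) :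
    Pfam N k l ≤ C.C k l := by
  rw [← allDual_C]
  refine Submodule.span_le.2 ?_
  rintro _ ⟨r, -, rfl⟩
  obtain ⟨n, ⟨e⟩⟩ := Finite.exists_equiv_fin (Quotient r)
  let lab : Fin k ⊕ Fin l → ℕ := fun x => e (Quotient.mk r x)
  have hlab : r = Setoid.ker lab := by
    ext x y
    rw [Setoid.ker_def]
    simp only [lab, ← Fin.ext_iff, e.apply_eq_iff_eq]
    exact Quotient.eq.symm
  let σ := Tuple.sort (lab ∘ Sum.inl)
  let τ := Tuple.sort (lab ∘ Sum.inr)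
  have hNCr : IsNC (Setoid.comap (Sum.map σ τ) r) := by
    have := isNC_ker_of_monotone (Tuple.monotone_sort (lab ∘ Sum.inl))
      (Tuple.monotone_sort (lab ∘ Sum.inr))
    convert this using 1
    rw [hlab]
    ext (x | x) (y | y) <;> rfl
  rw [setoidMat_eq_perm_mul N r σ τ]
  exact C.comp_mem (C.comp_mem (permMat_mem C hNC hX _)
    (hNC _ _ (setoidMat_mem_NCfam N hNCr))) (permMat_mem C hNC hX _)

/-- The crossing pairing of four points. -/
def crossing : Setoid (Fin 4) := Setoid.ker ![0, 1, 0, 1]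

theorem swap_mem_of_crossing_mem {N : ℕ} (C : TKDual N) (hNC : ∀ a b, NCfam N a b ≤ C.C a b)
    (hX : vecMat (setoidVec N crossing) ∈ C.C 0 4) :
    permMat N (Equiv.swap (0 : Fin 2) 1) ∈ C.C 2 2 := by
  have hr : IsNC (Setoid.ker (Sum.elim ![0, 1, 1, 0, 2, 3] ![2, 3] :
      Fin (2 + 4) ⊕ Fin 2 → ℕ)) := by
    have : ∀ a b c d : Fin (2 + 4) ⊕ Fin 2, wordPos _ _ a < wordPos _ _ b →
        wordPos _ _ b < wordPos _ _ c → wordPos _ _ c < wordPos _ _ d →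
        (Sum.elim ![0, 1, 1, 0, 2, 3] ![2, 3] : Fin (2 + 4) ⊕ Fin 2 → ℕ) a =
          Sum.elim ![0, 1, 1, 0, 2, 3] ![2, 3] c →
        (Sum.elim ![0, 1, 1, 0, 2, 3] ![2, 3] : Fin (2 + 4) ⊕ Fin 2 → ℕ) b =
          Sum.elim ![0, 1, 1, 0, 2, 3] ![2, 3] d →
        (Sum.elim ![0, 1, 1, 0, 2, 3] ![2, 3] : Fin (2 + 4) ⊕ Fin 2 → ℕ) a =
          Sum.elim ![0, 1, 1, 0, 2, 3] ![2, 3] b := by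
      decide
    exact fun a b c d _ _ _ _ => this a b c d
  have h1 := C.comp_mem (hNC _ _ (setoidMat_mem_NCfam N hr))
    (C.tensor_mem (hNC _ _ (one_mem_NCfam N 2)) hX)
  convert h1 using 1
  ext i j
  have e1 : ∀ m : Fin (2 + 4) → Fin N, ConstOn (Setoid.ker
      (Sum.elim ![0, 1, 1, 0, 2, 3] ![2, 3] : Fin (2 + 4) ⊕ Fin 2 → ℕ)) (Sum.elim m i) ↔
      m 0 = m 3 ∧ m 1 = m 2 ∧ m 4 = i 0 ∧ m 5 = i 1 := by
    intro m
    constructor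
    · intro h
      exact ⟨h (.inl 0) (.inl 3) rfl, h (.inl 1) (.inl 2) rfl, h (.inl 4) (.inr 0) rfl,
        h (.inl 5) (.inr 1) rfl⟩
    · rintro ⟨h0, h1, h2, h3⟩ (x | x) (y | y) hxy <;> rw [Setoid.ker_def] at hxy <;>
        fin_cases x <;> fin_cases y <;> simp_all
  have e2 : ∀ m : Fin 4 → Fin N, ConstOn crossing m ↔ m 0 = m 2 ∧ m 1 = m 3 := by
    intro m
    constructor
    · intro h
      exact ⟨h 0 2 rfl, h 1 3 rfl⟩
    · rintro ⟨h0, h1⟩ x y hxy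
      rw [crossing, Setoid.ker_def] at hxy
      fin_cases x <;> fin_cases y <;> simp_all
  have e3 : i = j ∘ Equiv.swap (0 : Fin 2) 1 ↔ i 0 = j 1 ∧ i 1 = j 0 := by
    rw [funext_iff, Fin.forall_fin_two]
    simp
  rw [Matrix.mul_apply, Finset.sum_eq_single ![j 0, j 1, j 1, j 0, i 0, i 1]]
  · simp only [setoidMat, setoidVec, tensorMat, vecMat, permMat, e1, e2, e3, Matrix.one_apply]
    symm
    refine (congrArg₂ _ (if_pos ⟨rfl, rfl, rfl, rfl⟩)
      (congrArg₂ _ (if_pos ?_) (if_congr ?_ rfl rfl))).trans (by rw [one_mul, one_mul])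
    · ext t
      fin_cases t <;> rfl
    · change j 1 = i 0 ∧ j 0 = i 1 ↔ _
      exact and_congr eq_comm eq_comm
  · intro m _ hm
    simp only [setoidMat, setoidVec, tensorMat, Matrix.one_apply, e1]
    by_cases h1 : m 0 = m 3 ∧ m 1 = m 2 ∧ m 4 = i 0 ∧ m 5 = i 1
    · rw [if_neg (c := (fun a => m (Fin.castAdd 4 a)) = _), zero_mul, mul_zero]
      intro h
      have h2 : m 0 = j 0 := congrFun h 0
      have h3 : m 1 = j 1 := congrFun h 1
      apply hm
      ext t
      fin_cases t <;> simp_all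
    · rw [if_neg h1, zero_mul]
  · simp

/-- The setoid that joins each of `n` lower points `t` to the upper point `e t`, and joins the
upper points `x` and `y`. -/
def legSetoid {n k : ℕ} (e : Fin n → Fin k) (x y : Fin k) : Setoid (Fin k ⊕ Fin n) :=
  Setoid.ker fun u => (Function.update id y x : Fin k → Fin k) (Sum.elim id e u)

theorem legSetoid_apply {n k : ℕ} (e : Fin n → Fin k) (x y : Fin k) (u v : Fin k ⊕ Fin n) :
    legSetoid e x y u v ↔ (Function.update id y x : Fin k → Fin k) (Sum.elim id e u) =
      (Function.update id y x : Fin k → Fin k) (Sum.elim id e v) := Iff.rfl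

theorem isNC_legSetoid {n k : ℕ} {e : Fin n → Fin k} (he : StrictMono e) {x y : Fin k}
    (hxy : x ≤ y) (h : ∀ t, e t ≤ x ∨ y ≤ e t) : IsNC (legSetoid e x y) := by
  have hm : ∀ z : Fin k,
      (z : ℕ) = y ∧ ((Function.update id y x : Fin k → Fin k) z : ℕ) = x ∨
      (z : ℕ) ≠ y ∧ ((Function.update id y x : Fin k → Fin k) z : ℕ) = z := by
    intro z
    by_cases hz : z = y
    · subst hz
      simp
    · exact Or.inr ⟨fun h => hz (Fin.ext h), by rw [Function.update_of_ne hz]; rfl⟩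
  have hlt : ∀ s t : Fin n, s < t → (e s : ℕ) < e t := fun s t hst => he hst
  have hA : ∀ t, (e t : ℕ) ≤ x ∨ (y : ℕ) ≤ e t := h
  have hxy' : (x : ℕ) ≤ y := hxy
  rintro (a | a) (b | b) (c | c) (d | d) _ _ _ _ hab hbc hcd hac hbd <;>
    simp only [legSetoid_apply, Sum.elim_inl, Sum.elim_inr, id,
      wordPos_inl, wordPos_inr, Fin.ext_iff] at hab hbc hcd hac hbd ⊢ <;>
    try omega
  · have := hm a; have := hm b; have := hm c; have := hm d
    omega
  · have := hm a; have := hm b; have := hm c; have := hm (e d); have := hA d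
    omega
  · have := hm a; have := hm b; have := hm (e c); have := hm (e d); have := hA c
    have := hA d; have := hlt d c (by omega)
    omega
  · have := hm (e b); have := hm (e d); have := hA c; have := hlt c b (by omega)
    have := hlt d c (by omega)
    have := hm a; have := hm (e c)
    omega
  · have := hm (e b); have := hm (e d); have := hA c; have := hlt c b (by omega)
    have := hlt d c (by omega)
    have := hm (e a); have := hm (e c); have := hlt b a (by omega)
    omega

theorem constOn_legSetoid {n k : ℕ} {Y : Type*} (e : Fin n → Fin k) (x y : Fin k)
    (f : Fin k → Y) (g : Fin n → Y) :
    ConstOn (legSetoid e x y) (Sum.elim f g) ↔ f ∘ e = g ∧ f x = f y := by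
  constructor
  · intro h
    refine ⟨funext fun t => h (.inl (e t)) (.inr t) rfl, h (.inl x) (.inl y) ?_⟩
    by_cases hxy : x = y <;> simp [legSetoid_apply, hxy]
  · rintro ⟨rfl, hxy⟩ u v huv
    have hf : ∀ z, f ((Function.update id y x : Fin k → Fin k) z) = f z := by
      intro z
      by_cases hz : z = y
      · subst hz
        simpa using hxy
      · simp [hz]
    have hu : ∀ u, Sum.elim f (f ∘ e) u = f (Sum.elim id e u) := by
      rintro (u | u) <;> rfl
    rw [legSetoid_apply] at huv
    rw [hu, hu, ← hf, ← hf (Sum.elim id e v)]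
    exact congrArg f huv

theorem setoidMat_legSetoid_mul (N : ℕ) {n k : ℕ} (e : Fin n → Fin k) (x y : Fin k)
    (J : Setoid (Fin k)) :
    setoidMat N (legSetoid e x y) * vecMat (setoidVec N J) =
      (N : ℂ) ^ freeClasses e (mergeSetoid J x y) •
        vecMat (setoidVec N (Setoid.comap e (mergeSetoid J x y))) := by
  ext i j
  have h1 : ∀ f : Fin k → Fin N, setoidMat N (legSetoid e x y) i f * vecMat (setoidVec N J) f j =
      if f ∘ e = i ∧ ConstOn (mergeSetoid J x y) f then 1 else 0 := by
    intro f
    simp only [setoidMat, setoidVec, vecMat, constOn_legSetoid, constOn_mergeSetoid]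
    split_ifs <;> simp_all
  rw [Matrix.mul_apply, Finset.sum_congr rfl fun f _ => h1 f, Finset.sum_boole]
  refine (congrArg Nat.cast (Eq.trans (by congr!)
    (card_constOn e (mergeSetoid J x y) i))).trans ?_
  change _ = (N : ℂ) ^ _ * if _ then _ else _
  split_ifs <;> simp

/-! ### Reducing to four points -/

/-- No element of `{a, b, c, d}` lies strictly between `x` and `y`. -/
def NoneBetween {k : ℕ} (a b c d x y : Fin k) : Prop :=
  ∀ z, z = a ∨ z = b ∨ z = c ∨ z = d → z ≤ x ∨ y ≤ z

theorem noneBetween {k : ℕ} {a b c d x y : Fin k} (hab : a ≤ b) (hbc : b ≤ c) (hcd : c ≤ d)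
    (h : y ≤ a ∨ (a ≤ x ∧ y ≤ b) ∨ (b ≤ x ∧ y ≤ c) ∨ (c ≤ x ∧ y ≤ d) ∨ d ≤ x) :
    NoneBetween a b c d x y := by
  rintro _ (rfl | rfl | rfl | rfl) <;> omega

theorem strictMono_four {k : ℕ} {a b c d : Fin k} (hab : a < b) (hbc : b < c) (hcd : c < d) :
    StrictMono ![a, b, c, d] := by
  rw [Fin.strictMono_iff_lt_succ]
  intro i
  fin_cases i <;> assumption

theorem comap_eq_crossing {k : ℕ} {J : Setoid (Fin k)} {a b c d : Fin k}
    (h : CrossAt J a b c d) : Setoid.comap ![a, b, c, d] J = crossing := by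
  obtain ⟨-, -, -, hac, hbd, hab⟩ := h
  have hs : ∀ {x y}, J x y → J y x := J.symm'
  have ht : ∀ {x y z}, J x y → J y z → J x z := J.trans'
  have hr : ∀ x, J x x := J.refl'
  ext s t
  rw [Setoid.comap_rel, crossing, Setoid.ker_def]
  fin_cases s <;> fin_cases t <;> simp <;> grind

theorem vecMat_comap_mem {N k : ℕ} {J : Setoid (Fin k)} {a b c d : Fin k} (hab : a < b)
    (hbc : b < c) (hcd : c < d) (h : ¬ CrossAt J a b c d) :
    vecMat (setoidVec N (Setoid.comap ![a, b, c, d] J)) ∈ NCfam N 0 4 := by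
  rw [vecMat_setoidVec]
  refine setoidMat_mem_NCfam N (isNC_vecSetoid ?_)
  rintro s t u v ⟨hst, htu, huv, h1, h2, h3⟩
  obtain ⟨rfl, rfl, rfl, rfl⟩ : s = 0 ∧ t = 1 ∧ u = 2 ∧ v = 3 := by omega
  exact h ⟨hab, hbc, hcd, h1, h2, h3⟩

theorem reduction_mem {N k : ℕ} {C : TKDual N} (hNC : ∀ a b, NCfam N a b ≤ C.C a b)
    {P Q : Setoid (Fin k)} {α β : ℂ}
    (hmem : vecMat (α • setoidVec N P + β • setoidVec N Q) ∈ C.C 0 k)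
    {a b c d x y : Fin k} (hab : a < b) (hbc : b < c) (hcd : c < d) (hxy : x ≤ y)
    (hB : NoneBetween a b c d x y) :
    (α * (N : ℂ) ^ freeClasses ![a, b, c, d] (mergeSetoid P x y)) •
        vecMat (setoidVec N (Setoid.comap ![a, b, c, d] (mergeSetoid P x y))) +
      (β * (N : ℂ) ^ freeClasses ![a, b, c, d] (mergeSetoid Q x y)) •
        vecMat (setoidVec N (Setoid.comap ![a, b, c, d] (mergeSetoid Q x y))) ∈ C.C 0 4 := by
  have hleg : IsNC (legSetoid ![a, b, c, d] x y) := by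
    refine isNC_legSetoid (strictMono_four hab hbc hcd) hxy fun t => hB _ ?_
    fin_cases t <;> simp
  have h := C.comp_mem (hNC _ _ (setoidMat_mem_NCfam N hleg)) hmem
  have e : vecMat (α • setoidVec N P + β • setoidVec N Q) =
      α • vecMat (setoidVec N P) + β • vecMat (setoidVec N Q) := rfl
  rwa [e, Matrix.mul_add, Matrix.mul_smul, Matrix.mul_smul, setoidMat_legSetoid_mul,
    setoidMat_legSetoid_mul, smul_smul, smul_smul] at h

theorem crossAt_reduction {N k : ℕ} (hN : N ≠ 0) {C : TKDual N}
    (hNC : ∀ a b, NCfam N a b ≤ C.C a b)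
    (hX : vecMat (setoidVec N crossing) ∉ C.C 0 4) {P Q : Setoid (Fin k)} {α β : ℂ} (hα : α ≠ 0)
    (hmem : vecMat (α • setoidVec N P + β • setoidVec N Q) ∈ C.C 0 k)
    {a b c d x y : Fin k} (hxy : x ≤ y) (hB : NoneBetween a b c d x y)
    (hP : CrossAt (mergeSetoid P x y) a b c d) :
    CrossAt (mergeSetoid Q x y) a b c d ∧
      α * (N : ℂ) ^ freeClasses ![a, b, c, d] (mergeSetoid P x y) +
        β * (N : ℂ) ^ freeClasses ![a, b, c, d] (mergeSetoid Q x y) = 0 := by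
  have h := reduction_mem hNC hmem hP.1 hP.2.1 hP.2.2.1 hxy hB
  have hX' : ∀ t : ℂ, t • vecMat (setoidVec N crossing) ∈ C.C 0 4 → t = 0 := fun t ht => by
    by_contra h0
    exact hX (((C.C 0 4).smul_mem_iff h0).1 ht)
  rw [comap_eq_crossing hP] at h
  by_cases hQ : CrossAt (mergeSetoid Q x y) a b c d
  · rw [comap_eq_crossing hQ, ← add_smul] at h
    exact ⟨hQ, hX' _ h⟩
  · have hQ' := hNC _ _ (vecMat_comap_mem (N := N) hP.1 hP.2.1 hP.2.2.1 hQ)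
    have := hX' _ (((C.C 0 4).add_mem_iff_left ((C.C 0 4).smul_mem _ hQ')).1 h)
    exact absurd this (mul_ne_zero hα (pow_ne_zero _ (Nat.cast_ne_zero.2 hN)))

theorem freeClasses_ne {A X : Type*} [Fintype X] {N : ℕ} {e : A → X} {J J' : Setoid X}
    {g : A → Fin N} (hg : ConstOn (Setoid.comap e J) g) (hg' : ConstOn (Setoid.comap e J') g)
    (hle : ∀ f : X → Fin N, ConstOn J' f → ConstOn J f) {f : X → Fin N} (hfg : f ∘ e = g)
    (hf : ConstOn J f) (hf' : ¬ ConstOn J' f) : freeClasses e J' ≠ freeClasses e J := by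
  have h1 := card_constOn e J g
  have h2 := card_constOn e J' g
  rw [if_pos hg] at h1
  rw [if_pos hg'] at h2
  intro heq
  rw [heq, ← h1] at h2
  refine absurd h2 (Finset.card_lt_card (Finset.ssubset_iff_subset_ne.2 ⟨?_, ?_⟩)).ne
  · intro f' hf'
    rw [Finset.mem_filter] at hf' ⊢
    exact ⟨hf'.1, hf'.2.1, hle f' hf'.2.2⟩
  · intro h
    have := (Finset.ext_iff.1 h f).2 (Finset.mem_filter.2 ⟨Finset.mem_univ f, hfg, hf⟩)
    exact hf' (Finset.mem_filter.1 this).2.2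

/-- Merging two distinct classes of a setoid with a crossing at `a, b, c, d`, so that the crossing
persists, decreases the number of functions that are constant on classes. -/
theorem freeClasses_mergeSetoid_ne {k : ℕ} {Q : Setoid (Fin k)} {a b c d x y : Fin k}
    (hQ : CrossAt Q a b c d) (hQ' : CrossAt (mergeSetoid Q x y) a b c d) (hxy : ¬ Q x y) :
    freeClasses ![a, b, c, d] (mergeSetoid Q x y) ≠ freeClasses ![a, b, c, d] Q := by
  have hs : ∀ {x y}, Q x y → Q y x := Q.symm'
  have ht : ∀ {x y z}, Q x y → Q y z → Q x z := Q.trans'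
  have hr : ∀ x, Q x x := Q.refl'
  let g : Fin 4 → Fin 2 := ![0, 1, 0, 1]
  have hg : ConstOn crossing g := by
    intro s t hst
    rw [crossing, Setoid.ker_def] at hst
    fin_cases s <;> fin_cases t <;> simp_all [g]
  have hf : ∃ f : Fin k → Fin 2, (f ∘ ![a, b, c, d] = g ∧ ConstOn Q f) ∧ f x ≠ f y := by
    obtain ⟨-, -, -, hac, hbd, hnab⟩ := hQ
    suffices ∃ S : Set (Fin k), a ∉ S ∧ b ∈ S ∧ (∀ u v, Q u v → (u ∈ S ↔ v ∈ S)) ∧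
        ¬ (x ∈ S ↔ y ∈ S) by
      obtain ⟨S, ha, hb, hc, hd⟩ := this
      have hc' := (hc a c hac).not.1 ha
      have hd' := (hc b d hbd).1 hb
      refine ⟨fun z => if z ∈ S then 1 else 0, ⟨?_, ?_⟩, ?_⟩
      · ext t
        fin_cases t <;> simp [g, *]
      · intro u v huv
        simp only [hc u v huv]
      · by_cases hx : x ∈ S <;> by_cases hy : y ∈ S <;> simp_all
    by_cases hb : Q x b ↔ Q y b
    · by_cases hx : Q x a
      · refine ⟨{z | Q z b ∨ Q z y}, ?_⟩
        simp only [Set.mem_ofPred_eq]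
        grind
      · refine ⟨{z | Q z b ∨ Q z x}, ?_⟩
        simp only [Set.mem_ofPred_eq]
        grind
    · refine ⟨{z | Q z b}, ?_⟩
      simp only [Set.mem_ofPred_eq]
      grind
  obtain ⟨f, hf, hfxy⟩ := hf
  refine freeClasses_ne (N := 2) (g := g) (by rwa [comap_eq_crossing hQ])
    (by rwa [comap_eq_crossing hQ']) (fun f hf => ((constOn_mergeSetoid Q x y f).1 hf).1)
    hf.1 hf.2 fun hf => hfxy ((constOn_mergeSetoid Q x y f).1 hf).2

/-- If `Q` has all the crossings that `P` has, with and without the merging of two points, then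
`P` refines `Q`. -/
theorem rel_of_crossAt {k : ℕ} {P Q : Setoid (Fin k)}
    (h : ∀ {a b c d x y}, x ≤ y → NoneBetween a b c d x y →
      CrossAt (mergeSetoid P x y) a b c d → CrossAt (mergeSetoid Q x y) a b c d)
    (h' : ∀ {a b c d}, CrossAt Q a b c d → CrossAt P a b c d)
    (hm : ∀ {a b c d x y}, CrossAt P a b c d → x ≤ y → NoneBetween a b c d x y → P x y → Q x y)
    {a b c d : Fin k} (hP : CrossAt P a b c d) {x y : Fin k} (hxy : x < y) (hPxy : P x y) :
    Q x y := by
  have pQ : ∀ {a b c d}, CrossAt P a b c d → CrossAt Q a b c d := fun {a b c d} H => by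
    have := h (le_refl a) (fun z _ => le_total z a) (by rwa [mergeSetoid_eq_self (P.refl' a)])
    rwa [mergeSetoid_eq_self (Q.refl' a)] at this
  have ps : ∀ {x y}, P x y → P y x := P.symm'
  have pt : ∀ {x y z}, P x y → P y z → P x z := P.trans'
  have qs : ∀ {x y}, Q x y → Q y x := Q.symm'
  have qt : ∀ {x y z}, Q x y → Q y z → Q x z := Q.trans'
  by_contra hQxy
  have hQ := pQ hP
  obtain ⟨hab, hbc, hcd, hac, hbd, hnab⟩ := id hP
  obtain ⟨-, -, -, hac', hbd', hnab'⟩ := id hQ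
  have hn : ∀ {u v}, (v ≤ a ∨ (a ≤ u ∧ v ≤ b) ∨ (b ≤ u ∧ v ≤ c) ∨ (c ≤ u ∧ v ≤ d) ∨ d ≤ u) →
      u ≤ v → P u v → Q u v := fun H huv =>
    hm hP huv (noneBetween hab.le hbc.le hcd.le H)
  have ha : ∀ z, P z a → Q z a := by
    intro z hz
    rcases le_total z a with h1 | h1
    · exact hn (.inl le_rfl) h1 hz
    rcases le_total z b with h2 | h2
    · exact qs (hn (.inr (.inl ⟨le_rfl, h2⟩)) h1 (ps hz))
    rcases le_total z c with h3 | h3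
    · exact qt (hn (.inr (.inr (.inl ⟨h2, le_rfl⟩))) h3 (pt hz hac)) (qs hac')
    rcases le_total z d with h4 | h4
    · exact qs (qt hac' (hn (.inr (.inr (.inr (.inl ⟨le_rfl, h4⟩)))) h3 (ps (pt hz hac))))
    rcases eq_or_lt_of_le h4 with rfl | h4
    · exact absurd (pt (ps hz) (ps hbd)) hnab
    have H : CrossAt Q b c d z := pQ ⟨hbc, hcd, h4, hbd, pt (ps hac) (ps hz),
      fun h => hnab (pt hac (ps h))⟩
    exact qs (qt hac' H.2.2.2.2.1)
  have hb : ∀ z, P z b → Q z b := by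
    intro z hz
    rcases le_total d z with h1 | h1
    · exact qs (qt hbd' (hn (.inr (.inr (.inr (.inr le_rfl)))) h1 (ps (pt hz hbd))))
    rcases le_total c z with h2 | h2
    · exact qt (hn (.inr (.inr (.inr (.inl ⟨h2, le_rfl⟩)))) h1 (pt hz hbd)) (qs hbd')
    rcases le_total b z with h3 | h3
    · exact qs (hn (.inr (.inr (.inl ⟨le_rfl, h2⟩))) h3 (ps hz))
    rcases le_total a z with h4 | h4
    · exact hn (.inr (.inl ⟨h4, le_rfl⟩)) h3 hz
    rcases eq_or_lt_of_le h4 with rfl | h4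
    · exact absurd hz hnab
    have H : CrossAt Q z a b c := pQ ⟨h4, hab, hbc, hz, hac, fun h => hnab (pt (ps h) hz)⟩
    exact H.2.2.2.1
  have hxa : ¬ P x a := fun H => hQxy (qt (ha x H) (qs (ha y (pt (ps hPxy) H))))
  have hxb : ¬ P x b := fun H => hQxy (qt (hb x H) (qs (hb y (pt (ps hPxy) H))))
  have hsep : ∀ {u v}, P u v → ¬ P x u → ¬ (x < u ∧ u < y ∧ y < v) ∧ ¬ (u < x ∧ x < v ∧ v < y) := by
    refine fun {u v} huv hxu => ⟨fun H => ?_, fun H => ?_⟩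
    · have : CrossAt Q x u y v := pQ ⟨H.1, H.2.1, H.2.2, hPxy, huv, hxu⟩
      exact hQxy this.2.2.2.1
    · have : CrossAt Q u x v y := pQ ⟨H.1, H.2.1, H.2.2, huv, hPxy, fun h => hxu (ps h)⟩
      exact hQxy this.2.2.2.2.1
  have hsep1 := hsep hac hxa
  have hsep2 := hsep hbd hxb
  have hne : ∀ z, ¬ P x z → x ≠ z ∧ y ≠ z := fun z hz =>
    ⟨fun H => hz (H ▸ P.refl' x), fun H => hz (H ▸ hPxy)⟩
  have hxa' := hne a hxa
  have hxb' := hne b hxb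
  have hxc' := hne c fun H => hxa (pt H (ps hac))
  have hxd' := hne d fun H => hxb (pt H (ps hbd))
  have hnb : ¬ (y ≤ a ∨ (a ≤ x ∧ y ≤ b) ∨ (b ≤ x ∧ y ≤ c) ∨ (c ≤ x ∧ y ≤ d) ∨ d ≤ x) := fun H =>
    hQxy (hn (u := x) (v := y) H hxy.le hPxy)
  obtain ⟨hxa₁, hdy⟩ : x < a ∧ d < y := by omega
  have H : CrossAt (mergeSetoid Q x a) b c d y := by
    refine h hxa₁.le (noneBetween hbc.le hcd.le hdy.le (Or.inl hab.le)) ⟨hbc, hcd, hdy, Or.inl hbd,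
      Or.inr (Or.inr ⟨ps hac, hPxy⟩), ?_⟩
    rintro (h | ⟨h, -⟩ | ⟨h, -⟩)
    · exact hnab (pt hac (ps h))
    · exact hxb (ps h)
    · exact hnab (ps h)
  have hcy : Q c y := by
    rcases H.2.2.2.2.1 with h | ⟨h, h'⟩ | ⟨-, h⟩
    · exact h
    · exact absurd (qt (qs h) (qt (qs hac') h')) hQxy
    · exact absurd h hQxy
  have : CrossAt P b c d y := h' ⟨hbc, hcd, hdy, hbd', hcy, fun h => hnab' (qt hac' (qs h))⟩
  exact hxa (pt hPxy (pt (ps this.2.2.2.2.1) (ps hac)))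

theorem le_of_mem {N k : ℕ} (hN : 2 ≤ N) {C : TKDual N} (hNC : ∀ a b, NCfam N a b ≤ C.C a b)
    (hX : vecMat (setoidVec N crossing) ∉ C.C 0 4) {P Q : Setoid (Fin k)} {α β : ℂ} (hα : α ≠ 0)
    (hβ : β ≠ 0) (hmem : vecMat (α • setoidVec N P + β • setoidVec N Q) ∈ C.C 0 k)
    {a b c d : Fin k} (hP : CrossAt P a b c d) : P ≤ Q := by
  have hN0 : N ≠ 0 := by omega
  have hmem' : vecMat (β • setoidVec N Q + α • setoidVec N P) ∈ C.C 0 k := by rwa [add_comm]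
  have h : ∀ {a b c d x y}, x ≤ y → NoneBetween a b c d x y → CrossAt (mergeSetoid P x y) a b c d →
      CrossAt (mergeSetoid Q x y) a b c d ∧
      α * (N : ℂ) ^ freeClasses ![a, b, c, d] (mergeSetoid P x y) +
        β * (N : ℂ) ^ freeClasses ![a, b, c, d] (mergeSetoid Q x y) = 0 :=
    fun hxy hB => crossAt_reduction hN0 hNC hX hα hmem hxy hB
  have h₀ : ∀ {a b c d}, CrossAt P a b c d → CrossAt Q a b c d ∧
      α * (N : ℂ) ^ freeClasses ![a, b, c, d] P + β * (N : ℂ) ^ freeClasses ![a, b, c, d] Q = 0 := by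
    intro a b c d H
    have := h (le_refl a) (fun z _ => le_total z a) (by rwa [mergeSetoid_eq_self (P.refl' a)])
    rwa [mergeSetoid_eq_self (P.refl' a), mergeSetoid_eq_self (Q.refl' a)] at this
  have key : ∀ {x y}, x < y → P x y → Q x y := by
    refine fun {x y} hxy hPxy =>
      rel_of_crossAt (fun hxy hB H => (h hxy hB H).1) ?_ ?_ hP hxy hPxy
    · intro a b c d H
      have := (crossAt_reduction hN0 hNC hX hβ hmem' (le_refl a) (fun z _ => le_total z a)
        (by rwa [mergeSetoid_eq_self (Q.refl' a)])).1
      rwa [mergeSetoid_eq_self (P.refl' a)] at this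
    · intro a b c d x y H hxy hB hPxy
      by_contra hQxy
      have h1 := h₀ H
      have h2 := h hxy hB (by rwa [mergeSetoid_eq_self hPxy])
      rw [mergeSetoid_eq_self hPxy] at h2
      refine freeClasses_mergeSetoid_ne h1.1 h2.1 hQxy (Nat.pow_right_injective hN ?_)
      have := mul_left_cancel₀ hβ (add_left_cancel (h2.2.trans h1.2.symm))
      exact_mod_cast this
  intro x y hxy
  rcases lt_trichotomy x y with hlt | rfl | hlt
  · exact key hlt hxy
  · exact Q.refl' x
  · exact Q.symm' (key hlt (P.symm' hxy))

/-- A Tannaka–Krein dual that contains a combination of two distinct partition vectors, at least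
one of which has a crossing, contains all partitions. -/
theorem Pfam_le_of_crossAt {N k : ℕ} (hN : 2 ≤ N) {C : TKDual N}
    (hNC : ∀ a b, NCfam N a b ≤ C.C a b) {P Q : Setoid (Fin k)} (hPQ : P ≠ Q) {α β : ℂ}
    (hα : α ≠ 0) (hβ : β ≠ 0) (hmem : vecMat (α • setoidVec N P + β • setoidVec N Q) ∈ C.C 0 k)
    {a b c d : Fin k} (hP : CrossAt P a b c d) (k' l' : ℕ) : Pfam N k' l' ≤ C.C k' l' := by
  refine Pfam_le_of_swap_mem C hNC (swap_mem_of_crossing_mem C hNC ?_) k' l'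
  by_contra hX
  have hQ := (crossAt_reduction (by omega) hNC hX hα hmem (le_refl a) (fun z _ => le_total z a)
    (by rwa [mergeSetoid_eq_self (P.refl' a)])).1
  rw [mergeSetoid_eq_self (Q.refl' a)] at hQ
  exact hPQ (le_antisymm (le_of_mem hN hNC hX hα hβ hmem hP)
    (le_of_mem hN hNC hX hβ hα (by rwa [add_comm]) hQ))

/-- Banica: for `N ≥ 4`, distinct partitions `p ≠ q` of `[k]`, nonzero
`α, β ∈ ℂ`, and nonzero `ξ = α ξ_p + β ξ_q`, the Tannaka–Krein dual `⟨NC, ξ⟩`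
equals `P` or equals `NC`. -/
theorem stmt12 {N k : ℕ} (hN : 4 ≤ N)
    (p q : Finpartition (Finset.univ : Finset (Fin k))) (hpq : p ≠ q)
    (α β : ℂ) (hα : α ≠ 0) (hβ : β ≠ 0)
    (ξ : (Fin k → Fin N) → ℂ) (hξ : ξ = α • xi N p + β • xi N q) (hne : ξ ≠ 0) :
    (∀ k' ℓ', genNCxi N ξ k' ℓ' = Pfam N k' ℓ') ∨
    (∀ k' ℓ', genNCxi N ξ k' ℓ' = NCfam N k' ℓ') := by
  have hPQ : partSetoid p ≠ partSetoid q := fun h => hpq (partSetoid_injective h)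
  rw [xi_eq_setoidVec, xi_eq_setoidVec] at hξ
  have hξ' : vecMat ξ = α • setoidMat N (vecSetoid (partSetoid p)) +
      β • setoidMat N (vecSetoid (partSetoid q)) := by
    rw [← vecMat_setoidVec, ← vecMat_setoidVec, hξ]
    rfl
  have hle : ∀ D : TKDual N, (∀ a b, NCfam N a b ≤ D.C a b) → vecMat ξ ∈ D.C 0 k →
      ∀ k' l', genNCxi N ξ k' l' ≤ D.C k' l' := fun D h1 h2 k' l' =>
    iInf_le_of_le D (iInf_le_of_le h1 (iInf_le_of_le h2 le_rfl))
  by_cases h : (∀ a b c d, ¬ CrossAt (partSetoid p) a b c d) ∧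
      ∀ a b c d, ¬ CrossAt (partSetoid q) a b c d
  · refine Or.inr fun k' l' => le_antisymm ?_ (le_iInf fun C => le_iInf₂ fun hC _ => hC k' l')
    rw [← ncDual_C]
    refine hle _ (fun a b => (ncDual_C N a b).ge) ?_ k' l'
    rw [ncDual_C, hξ']
    exact add_mem (Submodule.smul_mem _ _ (setoidMat_mem_NCfam N (isNC_vecSetoid h.1)))
      (Submodule.smul_mem _ _ (setoidMat_mem_NCfam N (isNC_vecSetoid h.2)))
  · refine Or.inl fun k' l' => le_antisymm ?_ (le_iInf fun C => le_iInf₂ fun hC hmem => ?_)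
    · rw [← allDual_C]
      refine hle _ (fun a b => (NCfam_le_Pfam N a b).trans (allDual_C N a b).ge) ?_ k' l'
      rw [allDual_C, hξ']
      exact add_mem (Submodule.smul_mem _ _ (setoidMat_mem_Pfam N _))
        (Submodule.smul_mem _ _ (setoidMat_mem_Pfam N _))
    · rw [hξ] at hmem
      rw [not_and_or] at h
      push Not at h
      rcases h with ⟨a, b, c, d, h⟩ | ⟨a, b, c, d, h⟩
      · exact Pfam_le_of_crossAt (by omega) hC hPQ hα hβ hmem h k' l'
      · exact Pfam_le_of_crossAt (by omega) hC hPQ.symm hβ hα (by rwa [add_comm]) h k' l'
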